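/- arXiv:1003.5789 — 8 statements merged into one kernel-verified Lean document; each statement's English description precedes it below -/
import Mathlib

section
/- For every integer n ≥ 1, there exists a compact set A ⊆ ℝⁿ with μ(A) > 0 such that for every point x ∈ A there is a nonzero vector a ∈ ℝⁿ with μ(A ∩ (x + l_a)) ≤ μ(A)/(n+1). -/
open MeasureTheory
open scoped RealInnerProductSpace

/-- The closed halfspace through `x` with inner normal `a`:
`x + l_a = {y : ⟪y - x, a⟫ ≥ 0}`. -/
def halfspace {n : ℕ} (x a : EuclideanSpace ℝ (Fin n)) : Set (EuclideanSpace ℝ (Fin n)) :=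
  {y | 0 ≤ ⟪y - x, a⟫}

/-- The vertices of the standard corner simplex: the origin and the coordinate unit vectors. -/
noncomputable def simplexVertex (n : ℕ) : Option (Fin n) → EuclideanSpace ℝ (Fin n)
  | none => 0
  | some i => EuclideanSpace.single i 1

/-- A direction in which the given vertex of the corner simplex is extreme. -/
noncomputable def outerNormal (n : ℕ) : Option (Fin n) → EuclideanSpace ℝ (Fin n)
  | none => WithLp.toLp 2 fun _ => -1
  | some i => EuclideanSpace.single i 1

/-- A small closed ball around a vertex of the corner simplex. -/
def vertexBall (n : ℕ) (i : Option (Fin n)) : Set (EuclideanSpace ℝ (Fin n)) :=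
  Metric.closedBall (simplexVertex n i) (1 / (4 * n))

lemma outerNormal_ne_zero {n : ℕ} (hn : 1 ≤ n) (i : Option (Fin n)) : outerNormal n i ≠ 0 := by
  intro h
  cases i with
  | none => simpa [outerNormal] using congrArg (fun v => v.ofLp ⟨0, hn⟩) h
  | some i => simpa [outerNormal] using congrArg (fun v => v.ofLp i) h

lemma abs_sub_le_of_mem_vertexBall {n : ℕ} {i : Option (Fin n)} {x : EuclideanSpace ℝ (Fin n)}
    (hx : x ∈ vertexBall n i) (k : Fin n) : |x k - simplexVertex n i k| ≤ 1 / (4 * n) := by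
  have h := PiLp.norm_apply_le (x - simplexVertex n i) k
  rw [PiLp.sub_apply, Real.norm_eq_abs, ← dist_eq_norm] at h
  exact h.trans hx

lemma abs_sum_sub_le_of_mem_vertexBall {n : ℕ} (hn : 1 ≤ n) {i : Option (Fin n)}
    {x : EuclideanSpace ℝ (Fin n)} (hx : x ∈ vertexBall n i) :
    |∑ k, x k - ∑ k, simplexVertex n i k| ≤ 1 / 4 := by
  have hn' : (n : ℝ) ≠ 0 := by positivity
  calc |∑ k, x k - ∑ k, simplexVertex n i k|
      = |∑ k, (x k - simplexVertex n i k)| := by rw [Finset.sum_sub_distrib]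
    _ ≤ ∑ k, |x k - simplexVertex n i k| := Finset.abs_sum_le_sum_abs _ _
    _ ≤ ∑ _k : Fin n, 1 / (4 * (n : ℝ)) :=
        Finset.sum_le_sum fun k _ => abs_sub_le_of_mem_vertexBall hx k
    _ = 1 / 4 := by
        rw [Finset.sum_const, Finset.card_univ, Fintype.card_fin, nsmul_eq_mul]
        field_simp

lemma inner_outerNormal_neg {n : ℕ} (hn : 1 ≤ n) {i j : Option (Fin n)} (hij : i ≠ j)
    {x y : EuclideanSpace ℝ (Fin n)} (hx : x ∈ vertexBall n i) (hy : y ∈ vertexBall n j) :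
    ⟪y - x, outerNormal n i⟫ < 0 := by
  cases i with
  | none =>
    cases j with
    | none => exact absurd rfl hij
    | some j =>
      have h1 := abs_le.1 (abs_sum_sub_le_of_mem_vertexBall hn hx)
      have h2 := abs_le.1 (abs_sum_sub_le_of_mem_vertexBall hn hy)
      simp [simplexVertex, PiLp.single_apply] at h1 h2
      simp [outerNormal, PiLp.inner_apply]
      linarith [h1.2, h2.1]
  | some i =>
    have hr : 1 / (4 * (n : ℝ)) ≤ 1 / 4 := by
      have : (1 : ℝ) ≤ n := by exact_mod_cast hn
      exact one_div_le_one_div_of_le (by norm_num) (by linarith)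
    have h1 := abs_le.1 ((abs_sub_le_of_mem_vertexBall hx i).trans hr)
    have h2 := abs_le.1 ((abs_sub_le_of_mem_vertexBall hy i).trans hr)
    have hj : simplexVertex n j i = 0 := by
      cases j with
      | none => simp [simplexVertex]
      | some j =>
        have : i ≠ j := fun h => hij (congrArg some h)
        simp [simplexVertex, this]
    rw [hj] at h2
    simp [simplexVertex] at h1
    simp [outerNormal, EuclideanSpace.inner_single_right]
    linarith [h1.1, h2.2]

lemma pairwise_disjoint_vertexBall {n : ℕ} (hn : 1 ≤ n) :
    Pairwise (Function.onFun Disjoint (vertexBall n)) := by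
  intro i j hij
  refine Set.disjoint_left.2 fun x hi hj => ?_
  simpa using inner_outerNormal_neg hn hij hi hj

lemma volume_iUnion_vertexBall {n : ℕ} (hn : 1 ≤ n) (i : Option (Fin n)) :
    volume (⋃ j, vertexBall n j) = (n + 1) * volume (vertexBall n i) := by
  have h (j) : volume (vertexBall n j) = volume (vertexBall n i) := by
    simp only [vertexBall, Measure.addHaar_closedBall_center volume (simplexVertex n _)]
  rw [measure_iUnion (pairwise_disjoint_vertexBall hn)
    fun _ => Metric.isClosed_closedBall.measurableSet, tsum_fintype]
  simp [h]

/-- There exists a compact set `A ⊆ ℝⁿ` of positive measure such that for every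
`x ∈ A` some halfspace through `x` captures at most `μ(A)/(n+1)` of the measure of `A`. -/
theorem exists_bad_cake (n : ℕ) (hn : 1 ≤ n) :
    ∃ A : Set (EuclideanSpace ℝ (Fin n)), IsCompact A ∧ 0 < volume A ∧
      ∀ x ∈ A, ∃ a : EuclideanSpace ℝ (Fin n), a ≠ 0 ∧
        volume (A ∩ halfspace x a) ≤ volume A / (n + 1) := by
  refine ⟨⋃ i, vertexBall n i, isCompact_iUnion fun i => isCompact_closedBall _ _, ?_, ?_⟩
  · have h : 0 < volume (vertexBall n none) := Metric.measure_closedBall_pos _ _ (by positivity)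
    exact h.trans_le (measure_mono (Set.subset_iUnion _ _))
  · intro x hx
    obtain ⟨i, hi⟩ := Set.mem_iUnion.1 hx
    refine ⟨outerNormal n i, outerNormal_ne_zero hn i, ?_⟩
    have hsub : (⋃ j, vertexBall n j) ∩ halfspace x (outerNormal n i) ⊆ vertexBall n i := by
      rintro y ⟨hy, hxy⟩
      obtain ⟨j, hj⟩ := Set.mem_iUnion.1 hy
      by_cases hij : i = j
      · exact hij ▸ hj
      · exact absurd hxy (not_le.2 (inner_outerNormal_neg hn hij hi hj))
    refine (measure_mono hsub).trans ?_
    rw [volume_iUnion_vertexBall hn i, ENNReal.le_div_iff_mul_le (by simp) (by simp), mul_comm]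
end

section
/- Let A = ⋃_{i=0}^{n} (a_i − S), where a_i − S = {a_i − s : s ∈ S}. Then for every point x ∈ A there exists a nonzero vector a ∈ ℝⁿ such that μ(A ∩ (x + l_a)) ≤ μ(A)/(n+1). -/
open MeasureTheory
open scoped RealInnerProductSpace

/-- The hyperplane orthogonal to a nonzero vector is Lebesgue-null. -/
theorem volume_orthogonal_hyperplane {n : ℕ} {v : EuclideanSpace ℝ (Fin n)} (hv : v ≠ 0) :
    volume {y : EuclideanSpace ℝ (Fin n) | ⟪y, v⟫ = 0} = 0 := by
  have h := Measure.addHaar_submodule (volume : Measure (EuclideanSpace ℝ (Fin n)))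
    (ℝ ∙ v)ᗮ (by simpa [Submodule.orthogonal_eq_top_iff] using hv)
  convert h using 2
  ext y
  simp [Submodule.mem_orthogonal_singleton_iff_inner_left]

theorem volume_image_const_sub {n : ℕ} (c : EuclideanSpace ℝ (Fin n))
    (S : Set (EuclideanSpace ℝ (Fin n))) :
    volume ((fun s => c - s) '' S) = volume S := by
  have h : (fun s => c - s) '' S = (fun s => c - s) ⁻¹' S :=
    congrFun (Set.image_eq_preimage_of_inverse (fun _ => sub_sub_cancel _ _)
      (fun _ => sub_sub_cancel _ _)) S
  rw [h]
  exact (Measure.measurePreserving_sub_left volume c).measure_preimage_emb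
    (MeasurableEquiv.subLeft c).measurableEmbedding S

/-- For the union `A = ⋃ i (aᵢ - S)` of the reflected copies of the regular simplex `S`
through its vertices, every point `x ∈ A` admits a halfspace through `x` capturing at most
`μ(A)/(n+1)` of the measure of `A`. -/
theorem union_reflected_simplices_bad (n : ℕ) (hn : 1 ≤ n)
    (a : Fin (n + 1) → EuclideanSpace ℝ (Fin n))
    (hnorm : ∀ i, ‖a i‖ = 1)
    (hinner : ∀ i j, i ≠ j → ⟪a i, a j⟫ = -1 / n)
    (S : Set (EuclideanSpace ℝ (Fin n))) (hS : S = convexHull ℝ (Set.range a))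
    (A : Set (EuclideanSpace ℝ (Fin n))) (hA : A = ⋃ i, (fun s => a i - s) '' S) :
    ∀ x ∈ A, ∃ v : EuclideanSpace ℝ (Fin n), v ≠ 0 ∧
      volume (A ∩ halfspace x v) ≤ volume A / (n + 1) := by
  have hne : ∀ i, a i ≠ 0 := fun i h => by simpa [h] using hnorm i
  have hn0 : (0 : ℝ) < n := by exact_mod_cast hn
  have hself : ∀ i, ⟪a i, a i⟫ = 1 := fun i => by
    rw [real_inner_self_eq_norm_sq, hnorm, one_pow]
  have hlin : ∀ i, IsLinearMap ℝ (fun y : EuclideanSpace ℝ (Fin n) => ⟪y, a i⟫) := fun i =>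
    ⟨fun y z => inner_add_left y z _, fun c y => real_inner_smul_left y _ c⟩
  have hle : ∀ i, ∀ s ∈ S, ⟪s, a i⟫ ≤ 1 := by
    intro i s hs
    rw [hS] at hs
    refine convexHull_min ?_ (convex_halfSpace_le (hlin i) 1) hs
    rintro _ ⟨j, rfl⟩
    simpa [hnorm] using real_inner_le_norm (a j) (a i)
  have hge : ∀ i, ∀ s ∈ S, -1 / n ≤ ⟪s, a i⟫ := by
    intro i s hs
    rw [hS] at hs
    refine convexHull_min ?_ (convex_halfSpace_ge (hlin i) (-1 / n)) hs
    rintro _ ⟨j, rfl⟩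
    show -1 / (n : ℝ) ≤ ⟪a j, a i⟫
    rcases eq_or_ne j i with rfl | h
    · rw [hself]
      exact (div_nonpos_of_nonpos_of_nonneg (by norm_num) hn0.le).trans zero_le_one
    · exact (hinner j i h).ge
  set T : Fin (n + 1) → Set (EuclideanSpace ℝ (Fin n)) := fun i => (fun s => a i - s) '' S with hT
  have hpos : ∀ i, ∀ y ∈ T i, 0 ≤ ⟪y, a i⟫ := by
    rintro i _ ⟨s, hs, rfl⟩
    simpa only [inner_sub_left, hself, sub_nonneg] using hle i s hs
  have hneg : ∀ i j, j ≠ i → ∀ y ∈ T j, ⟪y, a i⟫ ≤ 0 := by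
    rintro i j hji _ ⟨s, hs, rfl⟩
    rw [inner_sub_left, hinner j i hji]
    linarith [hge i s hs]
  have hvolT : ∀ i, volume (T i) = volume S := fun i => volume_image_const_sub (a i) S
  have hScompact : IsCompact S := hS ▸ (Set.finite_range a).isCompact_convexHull (𝕜 := ℝ)
  have hmeas : ∀ i, MeasurableSet (T i) := fun i =>
    (hScompact.image (by fun_prop)).measurableSet
  have hdisj : Pairwise (Function.onFun (AEDisjoint volume) T) := fun i j hij =>
    measure_mono_null (fun y hy => le_antisymm (hneg i j hij.symm y hy.2) (hpos i y hy.1))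
      (volume_orthogonal_hyperplane (hne i))
  have hvolA : volume A = (n + 1) * volume S := by
    rw [hA, measure_iUnion₀ hdisj fun i => (hmeas i).nullMeasurableSet, tsum_fintype]
    simp [hvolT]
  intro x hx
  obtain ⟨i, hxi⟩ := Set.mem_iUnion.1 (hA ▸ hx)
  refine ⟨a i, hne i, ?_⟩
  have hsub : A ∩ halfspace x (a i) ⊆ T i ∪ {y | ⟪y, a i⟫ = 0} := by
    rintro y ⟨hyA, hy⟩
    obtain ⟨j, hyj⟩ := Set.mem_iUnion.1 (hA ▸ hyA)
    rcases eq_or_ne j i with rfl | h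
    · exact Or.inl hyj
    · have hy' : 0 ≤ ⟪y - x, a i⟫ := hy
      rw [inner_sub_left] at hy'
      exact Or.inr (le_antisymm (hneg i j h y hyj) (by linarith [hpos i x hxi]))
  calc volume (A ∩ halfspace x (a i))
      ≤ volume (T i ∪ {y | ⟪y, a i⟫ = 0}) := measure_mono hsub
    _ ≤ volume (T i) + volume {y | ⟪y, a i⟫ = 0} := measure_union_le _ _
    _ = volume S := by rw [hvolT, volume_orthogonal_hyperplane (hne i), add_zero]
    _ = volume A / (n + 1) := by
      rw [hvolA, mul_comm, ENNReal.mul_div_cancel_right (by simp) (by finiteness)]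
end

section
/- For every compact set A ⊆ ℝⁿ with μ(A) > 0, the intersection over all nonzero vectors a ∈ ℝⁿ of the sets {x ∈ ℝⁿ : μ(A ∩ (x + l_a)) ≥ μ(A)/(n+1)} is nonempty; that is, there exists a point c ∈ ℝⁿ such that every closed halfspace whose boundary hyperplane passes through c contains at least a 1/(n+1) fraction of the measure of A. -/
open MeasureTheory
open scoped RealInnerProductSpace

section Halfspace

variable {n : ℕ} {A : Set (EuclideanSpace ℝ (Fin n))} {a : EuclideanSpace ℝ (Fin n)} {c : ENNReal}

lemma mem_halfspace_iff {x y : EuclideanSpace ℝ (Fin n)} :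
    y ∈ halfspace x a ↔ ⟪x, a⟫ ≤ ⟪y, a⟫ := by
  simp [halfspace, inner_sub_left]

lemma halfspace_subset_halfspace {x z : EuclideanSpace ℝ (Fin n)} (h : ⟪z, a⟫ ≤ ⟪x, a⟫) :
    halfspace x a ⊆ halfspace z a := fun _ hy ↦
  mem_halfspace_iff.2 (h.trans (mem_halfspace_iff.1 hy))

/-- The points `x` for which the halfspace through `x` contains mass at least `c` of `A`
form a convex set. -/
lemma convex_setOf_le_volume_inter_halfspace :
    Convex ℝ {x | c ≤ volume (A ∩ halfspace x a)} := by
  have hmono {x z : EuclideanSpace ℝ (Fin n)} (h : ⟪z, a⟫ ≤ ⟪x, a⟫)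
      (hx : c ≤ volume (A ∩ halfspace x a)) : c ≤ volume (A ∩ halfspace z a) :=
    hx.trans (measure_mono (Set.inter_subset_inter_right A (halfspace_subset_halfspace h)))
  intro x hx y hy s t hs ht hst
  have hz : ⟪s • x + t • y, a⟫ = s * ⟪x, a⟫ + t * ⟪y, a⟫ := by
    simp [inner_add_left, real_inner_smul_left]
  have hle := Convex.combo_le_max (⟪x, a⟫ : ℝ) ⟪y, a⟫ hs ht hst
  rw [smul_eq_mul, smul_eq_mul, ← hz] at hle
  rcases le_max_iff.1 hle with h | h
  · exact hmono h hx
  · exact hmono h hy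

/-- The points `x` for which the halfspace through `x` contains mass at least `c` of the compact
set `A` form a closed set. -/
lemma IsCompact.isClosed_setOf_le_volume_inter_halfspace (hA : IsCompact A) :
    IsClosed {x | c ≤ volume (A ∩ halfspace x a)} := by
  rw [← isOpen_compl_iff, isOpen_iff_eventually]
  intro x hx
  rw [Set.mem_compl_iff, Set.mem_ofPred_eq, not_le] at hx
  obtain ⟨U, hU, hUo, hUc⟩ := Set.exists_isOpen_lt_of_lt _ _ hx
  have hnear : ∀ᶠ z in nhds x, ∀ y ∈ A \ U, ⟪y, a⟫ < ⟪z, a⟫ := by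
    refine (hA.diff hUo).eventually_forall_of_forall_eventually fun y hy ↦ ?_
    have hlt : ⟪y, a⟫ < ⟪x, a⟫ := by
      by_contra! h
      exact hy.2 (hU ⟨hy.1, mem_halfspace_iff.2 h⟩)
    exact (isOpen_lt (f := fun p : EuclideanSpace ℝ (Fin n) × EuclideanSpace ℝ (Fin n) ↦ ⟪p.2, a⟫)
      (g := fun p ↦ ⟪p.1, a⟫) (by fun_prop) (by fun_prop)).mem_nhds hlt
  filter_upwards [hnear] with z hz
  rw [Set.mem_compl_iff, Set.mem_ofPred_eq, not_le]
  refine (measure_mono fun y hy ↦ ?_).trans_lt hUc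
  by_contra hyU
  exact (hz y ⟨hy.1, hyU⟩).not_ge (mem_halfspace_iff.1 hy.2)

/-- The points `x` of a compact set `A` for which the halfspace through `x` contains mass less than
`c` of `A` have total mass at most `c`. -/
lemma IsCompact.volume_diff_setOf_le_volume_inter_halfspace_le (hA : IsCompact A) :
    volume (A \ {x | c ≤ volume (A ∩ halfspace x a)}) ≤ c := by
  rw [(hA.measurableSet.diff
    hA.isClosed_setOf_le_volume_inter_halfspace.measurableSet).measure_eq_iSup_isCompact]
  refine iSup₂_le fun K hKA ↦ iSup_le fun hK ↦ ?_
  rcases K.eq_empty_or_nonempty with rfl | hne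
  · simp
  obtain ⟨x, hxK, hx⟩ := hK.exists_isMinOn hne
    (f := fun y ↦ ⟪y, a⟫) (by fun_prop)
  have hsub : K ⊆ A ∩ halfspace x a := fun y hy ↦ ⟨(hKA hy).1, mem_halfspace_iff.2 (hx hy)⟩
  exact (measure_mono hsub).trans (not_le.1 (hKA hxK).2).le

end Halfspace

/-- For every compact `A ⊆ ℝⁿ` of positive measure, the intersection over all nonzero `a`
of `{x : μ(A ∩ (x + l_a)) ≥ μ(A)/(n+1)}` is nonempty. -/
theorem inter_good_halfspaces_nonempty (n : ℕ) (hn : 1 ≤ n)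
    (A : Set (EuclideanSpace ℝ (Fin n))) (hA : IsCompact A) (hA0 : 0 < volume A) :
    (⋂ a : {a : EuclideanSpace ℝ (Fin n) // a ≠ 0},
      {x : EuclideanSpace ℝ (Fin n) |
        volume A / (n + 1) ≤ volume (A ∩ halfspace x a.1)}).Nonempty := by
  obtain ⟨R, hR⟩ := hA.isBounded.subset_closedBall 0
  -- Thresholds strictly below `μ(A)/(n+1)` leave room for a union bound.
  let F (p : EuclideanSpace ℝ (Fin n) × Set.Iio (volume A / (n + 1))) :
      Set (EuclideanSpace ℝ (Fin n)) := {x | p.2.1 ≤ volume (A ∩ halfspace x p.1)}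
  have hF : (⋂ p, F p ∩ Metric.closedBall 0 R).Nonempty := by
    refine Convex.helly_theorem_compact' (𝕜 := ℝ)
      (fun p ↦ convex_setOf_le_volume_inter_halfspace.inter (convex_closedBall 0 R))
      (fun p ↦ (isCompact_closedBall 0 R).inter_left
        hA.isClosed_setOf_le_volume_inter_halfspace) fun I hI ↦ ?_
    rw [finrank_euclideanSpace_fin] at hI
    have hsum : ∑ p ∈ I, p.2.1 < volume A := by
      rcases I.eq_empty_or_nonempty with rfl | hne
      · simpa using hA0
      calc ∑ p ∈ I, p.2.1 < ∑ _p ∈ I, volume A / (n + 1) :=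
            ENNReal.sum_lt_sum_of_nonempty hne fun p _ ↦ p.2.2
        _ = I.card * (volume A / (n + 1)) := by simp
        _ ≤ (n + 1) * (volume A / (n + 1)) := by gcongr; exact_mod_cast hI
        _ ≤ volume A := ENNReal.mul_div_le
    obtain ⟨x, hxA, hx⟩ : ∃ x ∈ A, ∀ p ∈ I, x ∈ F p := by
      by_contra! h
      refine hsum.not_ge ?_
      calc volume A ≤ volume (⋃ p ∈ I, A \ F p) := measure_mono fun x hxA ↦ by
            obtain ⟨p, hpI, hp⟩ := h x hxA
            exact Set.mem_biUnion hpI ⟨hxA, hp⟩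
        _ ≤ ∑ p ∈ I, volume (A \ F p) := measure_biUnion_finset_le _ _
        _ ≤ ∑ p ∈ I, p.2.1 := Finset.sum_le_sum fun p _ ↦
            hA.volume_diff_setOf_le_volume_inter_halfspace_le
    exact ⟨x, Set.mem_iInter₂.2 fun p hp ↦ ⟨hx p hp, hR hxA⟩⟩
  obtain ⟨x, hx⟩ := hF
  exact ⟨x, Set.mem_iInter.2 fun a ↦ le_of_forall_lt_imp_le_of_dense fun c hc ↦
    (Set.mem_iInter.1 hx (a.1, ⟨c, hc⟩)).1⟩
end

section
/- For all indices i ≠ j, the sets a_i − S = {a_i − s : s ∈ S} and a_j − S = {a_j − s : s ∈ S} intersect exactly in the single point 0, i.e. (a_i − S) ∩ (a_j − S) = {0}. -/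
open MeasureTheory
open scoped RealInnerProductSpace

section RegularSimplex

variable {E : Type*} [NormedAddCommGroup E] [InnerProductSpace ℝ E]

theorem norm_le_of_mem_convexHull_range {ι : Type*} {a : ι → E} {r : ℝ}
    (h : ∀ i, ‖a i‖ ≤ r) {x : E} (hx : x ∈ convexHull ℝ (Set.range a)) : ‖x‖ ≤ r := by
  have hsub : convexHull ℝ (Set.range a) ⊆ Metric.closedBall 0 r :=
    convexHull_min (by rintro _ ⟨i, rfl⟩; simpa using h i) (convex_closedBall 0 r)
  simpa using hsub hx

theorem le_inner_of_mem_convexHull_range {ι : Type*} {a : ι → E} {b : E} {c : ℝ}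
    (h : ∀ i, c ≤ ⟪b, a i⟫) {x : E} (hx : x ∈ convexHull ℝ (Set.range a)) : c ≤ ⟪b, x⟫ := by
  have hsub : convexHull ℝ (Set.range a) ⊆ {y | c ≤ ⟪b, y⟫} :=
    convexHull_min (by rintro _ ⟨i, rfl⟩; exact h i)
      (convex_halfSpace_ge (innerSL ℝ b).toLinearMap.isLinear c)
  exact hsub hx

theorem eq_of_norm_le_one_of_one_le_inner {x u : E} (hx : ‖x‖ ≤ 1) (hu : ‖u‖ = 1)
    (h : 1 ≤ ⟪u, x⟫) : u = x := by
  have hsq := norm_sub_sq_real u x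
  have hzero : ‖u - x‖ = 0 := by
    rw [hu] at hsq
    nlinarith [norm_nonneg x, sq_nonneg ‖u - x‖]
  exact sub_eq_zero.mp (norm_eq_zero.mp hzero)

end RegularSimplex

/-- Distinct reflected copies `aᵢ - S` and `aⱼ - S` of the regular simplex `S` through
its vertices meet exactly in the origin. -/
theorem reflected_simplices_inter (n : ℕ) (hn : 1 ≤ n)
    (a : Fin (n + 1) → EuclideanSpace ℝ (Fin n))
    (hnorm : ∀ i, ‖a i‖ = 1)
    (hinner : ∀ i j, i ≠ j → ⟪a i, a j⟫ = -1 / n)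
    (S : Set (EuclideanSpace ℝ (Fin n))) (hS : S = convexHull ℝ (Set.range a)) :
    ∀ i j, i ≠ j →
      ((fun s => a i - s) '' S) ∩ ((fun s => a j - s) '' S) = {0} := by
  subst hS
  intro i j hij
  have hlow : ∀ k, ∀ x ∈ convexHull ℝ (Set.range a), -1 / (n : ℝ) ≤ ⟪a k, x⟫ := by
    intro k x hx
    refine le_inner_of_mem_convexHull_range (fun l => ?_) hx
    rcases eq_or_ne k l with rfl | hkl
    · rw [real_inner_self_eq_norm_sq, hnorm, neg_div]
      have : (0 : ℝ) ≤ 1 / n := by positivity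
      linarith
    · exact (hinner k l hkl).ge
  have hball : ∀ x ∈ convexHull ℝ (Set.range a), ‖x‖ ≤ 1 := fun x hx =>
    norm_le_of_mem_convexHull_range (fun k => (hnorm k).le) hx
  have hmem : ∀ k, a k ∈ convexHull ℝ (Set.range a) := fun k =>
    subset_convexHull ℝ _ (Set.mem_range_self k)
  refine Set.Subset.antisymm ?_ ?_
  · rintro _ ⟨⟨s, hs, rfl⟩, t, ht, hst⟩
    have hi : ⟪a i, a j - t⟫ = ⟪a i, a i - s⟫ := congrArg (fun y => ⟪a i, y⟫) hst
    simp only [inner_sub_right, real_inner_self_eq_norm_sq, hnorm, hinner i j hij] at hi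
    have hs_eq : a i = s :=
      eq_of_norm_le_one_of_one_le_inner (hball s hs) (hnorm i)
        (by linarith [hlow i t ht])
    simp [hs_eq]
  · rintro _ rfl
    exact ⟨⟨a i, hmem i, sub_self _⟩, a j, hmem j, sub_self _⟩
end

section
/- The Lebesgue measure of the union A = ⋃_{i=0}^{n} (a_i − S), where a_i − S = {a_i − s : s ∈ S}, equals (n+1) times the Lebesgue measure of S: μ(A) = (n+1) μ(S). -/
open MeasureTheory
open scoped RealInnerProductSpace

/-- The vertices of a regular simplex inscribed in the unit sphere sum to zero. -/
lemma sum_eq_zero_of_regular_simplex {E : Type*} [NormedAddCommGroup E] [InnerProductSpace ℝ E]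
    {n : ℕ} (hn : 1 ≤ n) {a : Fin (n + 1) → E} (hnorm : ∀ i, ‖a i‖ = 1)
    (hinner : ∀ i j, i ≠ j → ⟪a i, a j⟫ = -1 / n) : ∑ i, a i = 0 := by
  have hn' : (n : ℝ) ≠ 0 := by positivity
  have h : ∀ i, ∑ j, ⟪a i, a j⟫ = 0 := by
    intro i
    rw [← Finset.add_sum_erase _ _ (Finset.mem_univ i), real_inner_self_eq_norm_sq, hnorm,
      Finset.sum_congr rfl fun j hj => hinner i j (Finset.ne_of_mem_erase hj).symm]
    simp [Finset.card_erase_of_mem]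
    field_simp
    norm_num
  rw [← inner_self_eq_zero (𝕜 := ℝ), sum_inner]
  simp [inner_sum, h]

/-- A regular simplex inscribed in the unit sphere lies in the halfspaces bounded by its facets. -/
lemma neg_inv_le_inner_of_mem_convexHull {E : Type*} [NormedAddCommGroup E]
    [InnerProductSpace ℝ E] {n : ℕ} {a : Fin (n + 1) → E} (hnorm : ∀ i, ‖a i‖ = 1)
    (hinner : ∀ i j, i ≠ j → ⟪a i, a j⟫ = -1 / n) {s : E}
    (hs : s ∈ convexHull ℝ (Set.range a)) (k : Fin (n + 1)) : -1 / (n : ℝ) ≤ ⟪a k, s⟫ := by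
  refine convexHull_min (t := {s | -1 / (n : ℝ) ≤ ⟪a k, s⟫}) ?_
    (convex_halfSpace_ge (innerₗ E (a k)).isLinear _) hs
  rintro _ ⟨j, rfl⟩
  by_cases h : k = j
  · subst h
    rw [Set.mem_ofPred_eq, real_inner_self_eq_norm_sq, hnorm]
    have : 0 ≤ 1 / (n : ℝ) := by positivity
    rw [neg_div]
    linarith
  · exact (hinner k j h).ge

/-- Distinct reflected simplices `aᵢ - S` and `aⱼ - S` meet only at the origin. -/
lemma reflected_simplices_inter_subset {E : Type*} [NormedAddCommGroup E]
    [InnerProductSpace ℝ E] {n : ℕ} (hn : 1 ≤ n) {a : Fin (n + 1) → E}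
    (hnorm : ∀ i, ‖a i‖ = 1) (hinner : ∀ i j, i ≠ j → ⟪a i, a j⟫ = -1 / n)
    {i j : Fin (n + 1)} (hij : i ≠ j) :
    (fun s => a i - s) '' convexHull ℝ (Set.range a) ∩
      (fun s => a j - s) '' convexHull ℝ (Set.range a) ⊆ {0} := by
  have key : ∀ i k, k ≠ i → ∀ s ∈ convexHull ℝ (Set.range a), ⟪a k, a i - s⟫ ≤ 0 := by
    intro i k hk s hs
    rw [inner_sub_right, hinner k i hk]
    linarith [neg_inv_le_inner_of_mem_convexHull hnorm hinner hs k]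
  rintro x ⟨⟨s, hs, rfl⟩, ⟨t, ht, hst⟩⟩
  simp only at hst
  have hle : ∀ k ∈ Finset.univ, ⟪a k, a i - s⟫ ≤ 0 := by
    intro k _
    by_cases hk : k = i
    · rw [← hst]
      exact key j k (hk ▸ hij) t ht
    · exact key i k hk s hs
  have hsum : ∑ k, ⟪a k, a i - s⟫ = 0 := by
    rw [← sum_inner, sum_eq_zero_of_regular_simplex hn hnorm hinner, inner_zero_left]
  have hi := (Finset.sum_eq_zero_iff_of_nonpos hle).1 hsum i (Finset.mem_univ i)
  have hs1 : ‖s‖ ≤ 1 := by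
    have : s ∈ Metric.closedBall (0 : E) 1 := by
      refine convexHull_min ?_ (convex_closedBall _ _) hs
      rintro _ ⟨k, rfl⟩
      simp [hnorm]
    simpa using this
  rw [inner_sub_right, real_inner_self_eq_norm_sq, hnorm] at hi
  have hsq := norm_sub_sq_real (a i) s
  rw [hnorm] at hsq
  rw [Set.mem_singleton_iff, ← norm_eq_zero]
  nlinarith [norm_nonneg s, norm_nonneg (a i - s)]

/-- The measure of the union `A = ⋃ i (aᵢ - S)` equals `(n+1) · μ(S)`. -/
theorem volume_union_reflected_simplices (n : ℕ) (hn : 1 ≤ n)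
    (a : Fin (n + 1) → EuclideanSpace ℝ (Fin n))
    (hnorm : ∀ i, ‖a i‖ = 1)
    (hinner : ∀ i j, i ≠ j → ⟪a i, a j⟫ = -1 / n)
    (S : Set (EuclideanSpace ℝ (Fin n))) (hS : S = convexHull ℝ (Set.range a))
    (A : Set (EuclideanSpace ℝ (Fin n))) (hA : A = ⋃ i, (fun s => a i - s) '' S) :
    volume A = (n + 1) * volume S := by
  subst hS hA
  have : Nonempty (Fin n) := ⟨⟨0, hn⟩⟩
  have hcompact : IsCompact (convexHull ℝ (Set.range a)) :=
    (Set.finite_range a).isCompact_convexHull ℝ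
  rw [measure_iUnion₀]
  · have h : ∀ i, volume ((fun s => a i - s) '' convexHull ℝ (Set.range a)) =
        volume (convexHull ℝ (Set.range a)) := fun i =>
      ((Measure.measurePreserving_sub_left volume (a i)).measure_preimage_emb
        (MeasurableEquiv.subLeft (a i)).measurableEmbedding _).symm.trans
        (congrArg volume (Set.preimage_image_eq _ sub_right_injective))
    simp [h]
  · intro i j hij
    exact measure_mono_null (reflected_simplices_inter_subset hn hnorm hinner hij)
      (measure_singleton _)
  · exact fun i => (hcompact.image (by fun_prop)).measurableSet.nullMeasurableSet
end

section
/- Let a ∈ S be written as a = Σ_{i=0}^{n} λ_i a_i with all λ_i ≥ 0 and Σ λ_i = 1, and let j be an index with λ_j = max_i λ_i. Then the set a_j − S = {a_j − s : s ∈ S} is contained in the closed halfspace l_a = {x ∈ ℝⁿ : ⟪x, a⟫ ≥ 0}; that is, ⟪a_j − s, a⟫ ≥ 0 for every s ∈ S. -/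
open MeasureTheory
open scoped RealInnerProductSpace

/-- The inner product of a vertex of a regular simplex with an affine combination of the
vertices. -/
lemma inner_vertex_sum_smul {E ι : Type*} [NormedAddCommGroup E] [InnerProductSpace ℝ E]
    [Fintype ι] {a : ι → E} {c : ℝ} (hnorm : ∀ i, ‖a i‖ = 1)
    (hinner : ∀ i j, i ≠ j → ⟪a i, a j⟫ = c) {w : ι → ℝ} (hw : ∑ i, w i = 1) (i : ι) :
    ⟪a i, ∑ k, w k • a k⟫ = (1 - c) * w i + c := by
  classical
  have hterm : ∀ k, ⟪a i, w k • a k⟫ = w k * c + if i = k then w k * (1 - c) else 0 := by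
    intro k
    rw [real_inner_smul_right]
    split_ifs with h
    · subst h
      rw [real_inner_self_eq_norm_sq, hnorm]
      ring
    · rw [hinner i k h, add_zero]
  rw [inner_sum, Finset.sum_congr rfl fun k _ => hterm k, Finset.sum_add_distrib,
    ← Finset.sum_mul, hw, Finset.sum_ite_eq]
  simp only [Finset.mem_univ, if_true]
  ring

/-- If `x = Σ λᵢ aᵢ ∈ S` with `λᵢ ≥ 0`, `Σ λᵢ = 1`, and `λⱼ` is maximal, then the
reflected simplex `aⱼ - S` lies in the halfspace `l_x = {y : ⟪y, x⟫ ≥ 0}`. -/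
theorem reflected_simplex_subset_halfspace (n : ℕ) (hn : 1 ≤ n)
    (a : Fin (n + 1) → EuclideanSpace ℝ (Fin n))
    (hnorm : ∀ i, ‖a i‖ = 1)
    (hinner : ∀ i j, i ≠ j → ⟪a i, a j⟫ = -1 / n)
    (S : Set (EuclideanSpace ℝ (Fin n))) (hS : S = convexHull ℝ (Set.range a))
    (x : EuclideanSpace ℝ (Fin n)) (hx : x ∈ S)
    (lam : Fin (n + 1) → ℝ) (hlam0 : ∀ i, 0 ≤ lam i) (hlam1 : ∑ i, lam i = 1)
    (hrep : x = ∑ i, lam i • a i)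
    (j : Fin (n + 1)) (hj : ∀ i, lam i ≤ lam j) :
    ∀ s ∈ S, 0 ≤ ⟪a j - s, x⟫ := by
  intro s hs
  have hc : (0 : ℝ) ≤ 1 - -1 / n := by
    rw [neg_div, sub_neg_eq_add]
    positivity
  have hvertex : Set.range a ⊆ {y | ⟪y, x⟫ ≤ ⟪a j, x⟫} := by
    rintro _ ⟨i, rfl⟩
    rw [Set.mem_ofPred_eq, hrep, inner_vertex_sum_smul hnorm hinner hlam1,
      inner_vertex_sum_smul hnorm hinner hlam1]
    gcongr
    exact hj i
  have hconvex : Convex ℝ {y | ⟪y, x⟫ ≤ ⟪a j, x⟫} :=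
    convex_halfSpace_le ⟨fun y z => inner_add_left y z x, fun r y => real_inner_smul_left y x r⟩ _
  rw [inner_sub_left, sub_nonneg]
  exact convexHull_min hvertex hconvex (hS ▸ hs)
end

section
/- Let A ⊆ ℝⁿ be a compact set, let a ∈ ℝⁿ be a nonzero vector, and let t ∈ ℝ. Then the set A(a, t) = {x ∈ ℝⁿ : μ(A ∩ (x + l_a)) ≥ t} is closed and convex. -/
open MeasureTheory
open scoped RealInnerProductSpace

section Superlevel

variable {E : Type*} [MeasurableSpace E] {μ : Measure E} {A : Set E} {φ : E → ℝ}

theorem antitone_measureReal_inter_ge (hA : μ A ≠ ⊤) :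
    Antitone fun s : ℝ => (μ (A ∩ {y | s ≤ φ y})).toReal := fun _ _ h =>
  ENNReal.toReal_mono (measure_ne_top_of_subset Set.inter_subset_left hA)
    (measure_mono (Set.inter_subset_inter_right _ fun _ hy => h.trans hy))

theorem isClosed_setOf_le_measureReal_inter_ge (hA : μ A ≠ ⊤) (hAm : MeasurableSet A)
    (hφ : Measurable φ) (t : ℝ) :
    IsClosed {s : ℝ | t ≤ (μ (A ∩ {y | s ≤ φ y})).toReal} := by
  refine isClosed_of_closure_subset fun s hs => ?_
  have hmem : ∀ r < s, t ≤ (μ (A ∩ {y | r ≤ φ y})).toReal := fun r hr => by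
    obtain ⟨q, hrq, hq⟩ := mem_closure_iff.1 hs (Set.Ioi r) isOpen_Ioi hr
    exact le_trans hq (antitone_measureReal_inter_ge hA (le_of_lt hrq))
  obtain ⟨u, hu, hus, hlim⟩ := exists_seq_strictMono_tendsto s
  have hinter : ⋂ k, A ∩ {y | u k ≤ φ y} = A ∩ {y | s ≤ φ y} := by
    ext y
    simp only [Set.mem_iInter, Set.mem_inter_iff, Set.mem_ofPred_eq]
    exact ⟨fun h => ⟨(h 0).1, le_of_tendsto' hlim fun k => (h k).2⟩,
      fun h k => ⟨h.1, (hus k).le.trans h.2⟩⟩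
  have hfin : ∀ B : Set E, μ (A ∩ B) ≠ ⊤ := fun B =>
    measure_ne_top_of_subset Set.inter_subset_left hA
  have hmeas : Filter.Tendsto (fun k => μ (A ∩ {y | u k ≤ φ y})) Filter.atTop
      (nhds (μ (A ∩ {y | s ≤ φ y}))) := by
    rw [← hinter]
    exact tendsto_measure_iInter_atTop
      (fun k => (hAm.inter (measurableSet_le measurable_const hφ)).nullMeasurableSet)
      (fun i j hij => Set.inter_subset_inter_right _ fun _ hy => (hu.monotone hij).trans hy)
      ⟨0, hfin _⟩
  exact ge_of_tendsto' ((ENNReal.tendsto_toReal (hfin _)).comp hmeas) fun k => hmem _ (hus k)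

end Superlevel

theorem halfspace_eq_setOf_inner_le {n : ℕ} (x a : EuclideanSpace ℝ (Fin n)) :
    halfspace x a = {y | ⟪a, x⟫ ≤ ⟪a, y⟫} := by
  ext y
  simp [halfspace, real_inner_comm a, inner_sub_right]

/-- For a compact `A`, nonzero `a` and `t ∈ ℝ`, the set
`A(a,t) = {x : μ(A ∩ (x + l_a)) ≥ t}` is closed and convex. -/
theorem superlevel_closed_convex (n : ℕ) (hn : 1 ≤ n)
    (A : Set (EuclideanSpace ℝ (Fin n))) (hA : IsCompact A)
    (a : EuclideanSpace ℝ (Fin n)) (ha : a ≠ 0) (t : ℝ) :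
    IsClosed {x : EuclideanSpace ℝ (Fin n) | t ≤ (volume (A ∩ halfspace x a)).toReal} ∧
    Convex ℝ {x : EuclideanSpace ℝ (Fin n) | t ≤ (volume (A ∩ halfspace x a)).toReal} := by
  have hfin : volume A ≠ ⊤ := hA.measure_lt_top.ne
  simp only [halfspace_eq_setOf_inner_le]
  refine ⟨(isClosed_setOf_le_measureReal_inter_ge hfin hA.measurableSet
    (by fun_prop : Measurable fun y => ⟪a, y⟫) t).preimage
    (by fun_prop : Continuous fun x => ⟪a, x⟫), ?_⟩
  have hlower : IsLowerSet {s : ℝ | t ≤ (volume (A ∩ {y | s ≤ ⟪a, y⟫})).toReal} :=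
    fun _ _ h hs => le_trans hs (antitone_measureReal_inter_ge hfin h)
  exact hlower.ordConnected.convex.linear_preimage (innerₛₗ ℝ a)
end

section
/- Let A ⊆ ℝⁿ be a compact set with μ(A) > 0, let 0 < ε < 1/(n+1), and let c_0, …, c_n be n+1 nonzero vectors in ℝⁿ. Then there exists a point x ∈ A such that μ(A ∩ (x + l_{c_i})) ≥ (1/(n+1) − ε) μ(A) for every i = 0, …, n. -/
open MeasureTheory
open scoped RealInnerProductSpace

/-- The points whose upper level set of `g` has measure less than `θ` form a set of measure
at most `θ`. -/
theorem measure_setOf_measure_le_lt_le {α : Type*} [MeasurableSpace α] (ν : Measure α)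
    [IsFiniteMeasure ν] {g : α → ℝ} (hg : Measurable g) (θ : ENNReal) :
    ν {x | ν {y | g x ≤ g y} < θ} ≤ θ := by
  set U : Set ℝ := {t | ν {y | t ≤ g y} < θ}
  have hU : IsUpperSet U := fun s t hst hs =>
    (measure_mono fun _ hy => le_trans hst hy).trans_lt hs
  have hUm : MeasurableSet U := hU.ordConnected.measurableSet
  change ν (g ⁻¹' U) ≤ θ
  rw [← Measure.map_apply hg hUm, hUm.measure_eq_iSup_isCompact]
  refine iSup₂_le fun K hKU => iSup_le fun hK => ?_
  rcases K.eq_empty_or_nonempty with rfl | hne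
  · simp
  · obtain ⟨m, hmK, hm⟩ := hK.exists_isLeast hne
    rw [Measure.map_apply hg hK.measurableSet]
    have hmU : ν {y | m ≤ g y} < θ := hKU hmK
    have hsub : g ⁻¹' K ⊆ {y | m ≤ g y} := fun y hy => hm hy
    exact (measure_mono hsub).trans hmU.le

/-- For compact `A` of positive measure, `0 < ε < 1/(n+1)` and nonzero vectors
`c₀, …, cₙ`, there is `x ∈ A` with `μ(A ∩ (x + l_{cᵢ})) ≥ (1/(n+1) - ε) μ(A)` for all `i`. -/
theorem exists_simultaneous_eps (n : ℕ) (hn : 1 ≤ n)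
    (A : Set (EuclideanSpace ℝ (Fin n))) (hA : IsCompact A) (hA0 : 0 < volume A)
    (ε : ℝ) (hε0 : 0 < ε) (hε1 : ε < 1 / (n + 1))
    (c : Fin (n + 1) → EuclideanSpace ℝ (Fin n)) (hc : ∀ i, c i ≠ 0) :
    ∃ x ∈ A, ∀ i,
      (1 / (n + 1) - ε) * (volume A).toReal ≤ (volume (A ∩ halfspace x (c i))).toReal := by
  by_contra! hcon
  have hfin : volume A ≠ ⊤ := hA.measure_ne_top
  have hpos : 0 < (volume A).toReal := ENNReal.toReal_pos hA0.ne' hfin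
  have : IsFiniteMeasure (volume.restrict A) := ⟨by simpa using hfin.lt_top⟩
  set θ : ℝ := (1 / (n + 1) - ε) * (volume A).toReal
  have hθ0 : 0 ≤ θ := mul_nonneg (sub_nonneg.2 hε1.le) hpos.le
  have hg (i : Fin (n + 1)) : Measurable fun y : EuclideanSpace ℝ (Fin n) => ⟪y, c i⟫ := by
    fun_prop
  have hhalf (x : EuclideanSpace ℝ (Fin n)) (i : Fin (n + 1)) :
      volume.restrict A {y | ⟪x, c i⟫ ≤ ⟪y, c i⟫} = volume (A ∩ halfspace x (c i)) := by
    rw [Measure.restrict_apply (measurableSet_le measurable_const (hg i)), Set.inter_comm]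
    simp only [halfspace, inner_sub_left, sub_nonneg]
  let B (i : Fin (n + 1)) : Set (EuclideanSpace ℝ (Fin n)) :=
    {x | volume.restrict A {y | ⟪x, c i⟫ ≤ ⟪y, c i⟫} < ENNReal.ofReal θ}
  have hcover : A ⊆ ⋃ i, B i := fun x hx => by
    obtain ⟨i, hi⟩ := hcon x hx
    refine Set.mem_iUnion.2 ⟨i, ?_⟩
    change volume.restrict A _ < _
    rw [hhalf]
    exact (ENNReal.lt_ofReal_iff_toReal_lt
      (measure_ne_top_of_subset Set.inter_subset_left hfin)).2 hi
  have hle : volume A ≤ ENNReal.ofReal ((n + 1) * θ) := by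
    calc volume A = volume.restrict A A := (Measure.restrict_apply_self _ _).symm
      _ ≤ volume.restrict A (⋃ i, B i) := measure_mono hcover
      _ ≤ ∑ i, volume.restrict A (B i) := measure_iUnion_fintype_le _ _
      _ ≤ ∑ _i : Fin (n + 1), ENNReal.ofReal θ :=
        Finset.sum_le_sum fun i _ => measure_setOf_measure_le_lt_le _ (hg i) _
      _ = ENNReal.ofReal ((n + 1) * θ) := by
        rw [Finset.sum_const, Finset.card_univ, Fintype.card_fin, ← ENNReal.ofReal_nsmul,
          nsmul_eq_mul]
        push_cast
        rfl
  have hreal : (volume A).toReal ≤ (n + 1) * θ := ENNReal.toReal_le_of_le_ofReal (by positivity) hle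
  have hsum : (n + 1) * θ = (volume A).toReal - (n + 1) * ε * (volume A).toReal := by
    simp only [θ]
    field_simp
  have : 0 < (n + 1) * ε * (volume A).toReal := by positivity
  linarith
end
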